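/- arXiv:0801.2834 — 2 statements merged into one kernel-verified Lean document; each statement's English description precedes it below -/
import Mathlib

section
/- Let V be a finite-dimensional vector space over ℚ with dim V = ρ, let B : V × V → ℚ be a symmetric bilinear form, let I be a finite index set with #I ≥ ρ² + ρ + 1, and let (y_i)_{i∈I} be a family of vectors in V such that B(y_i, y_j) ≥ 0 whenever i ≠ j. Suppose that B(D, D) ≤ 0 for every vector D of the form D = Σ_{i∈I} a_i · y_i with all a_i nonnegative integers. Then there exist ρ + 1 pairwise distinct indices ν_1, …, ν_{ρ+1} ∈ I such that B(y_{ν_k}, y_{ν_l}) = 0 for all k ≠ l. -/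
/-- If two combinations with natural coefficients and disjoint supports agree, then the classes in
the support of the first one are orthogonal to all classes outside that support. -/
lemma bilin_eq_zero_of_disjoint_relation {V I : Type*} [AddCommGroup V] [Module ℚ V] [Fintype I]
    {B : LinearMap.BilinForm ℚ V} (hsymm : B.IsSymm) {y : I → V}
    (hnn : ∀ i j, i ≠ j → 0 ≤ B (y i) (y j))
    (hnopos : ∀ a : I → ℕ, B (∑ i, (a i : ℚ) • y i) (∑ i, (a i : ℚ) • y i) ≤ 0)
    {a b : I → ℕ} (hab : ∀ i, a i = 0 ∨ b i = 0)
    (hrel : ∑ i, (a i : ℚ) • y i = ∑ i, (b i : ℚ) • y i)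
    {i k : I} (hi : a i ≠ 0) (hk : a k = 0) : B (y i) (y k) = 0 := by
  classical
  have pair (c : I → ℕ) (k : I) :
      B (∑ i, (c i : ℚ) • y i) (y k) = ∑ i, (c i : ℚ) * B (y i) (y k) := by
    simp [LinearMap.sum_apply]
  have term_nonneg (c : I → ℕ) (k : I) (hc : c k = 0) (i : I) :
      0 ≤ (c i : ℚ) * B (y i) (y k) := by
    rcases eq_or_ne i k with rfl | h
    · simp [hc]
    · exact mul_nonneg (Nat.cast_nonneg _) (hnn i k h)
  have hpos (k : I) : 0 ≤ B (∑ i, (a i : ℚ) • y i) (y k) := by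
    rcases hab k with h | h
    · rw [pair]
      exact Finset.sum_nonneg fun i _ => term_nonneg a k h i
    · rw [hrel, pair]
      exact Finset.sum_nonneg fun i _ => term_nonneg b k h i
  have hself : 0 ≤ B (∑ i, (a i : ℚ) • y i) (∑ i, (a i : ℚ) • y i) := by
    rw [map_sum (B (∑ i, (a i : ℚ) • y i))]
    refine Finset.sum_nonneg fun j _ => ?_
    rw [map_smul, smul_eq_mul]
    exact mul_nonneg (Nat.cast_nonneg _) (hpos j)
  have hexpand (n : ℕ) : 2 * n * B (∑ i, (a i : ℚ) • y i) (y k) + B (y k) (y k) ≤ 0 := by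
    have h := hnopos fun i => n * a i + if i = k then 1 else 0
    have hsum : ∑ i, ((n * a i + if i = k then 1 else 0 : ℕ) : ℚ) • y i
        = (n : ℚ) • ∑ i, (a i : ℚ) • y i + y k := by
      simp [add_smul, Finset.sum_add_distrib, Finset.smul_sum, mul_smul]
    rw [hsum] at h
    generalize ∑ i, (a i : ℚ) • y i = D at h hself ⊢
    have hcomm : B (y k) D = B D (y k) := hsymm.eq _ _
    simp only [map_add, map_smul, LinearMap.add_apply, LinearMap.smul_apply, smul_eq_mul,
      hcomm] at h
    nlinarith [mul_nonneg (mul_self_nonneg (n : ℚ)) hself]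
  have hzero : B (∑ i, (a i : ℚ) • y i) (y k) = 0 := by
    refine le_antisymm (not_lt.mp fun hlt => ?_) (hpos k)
    obtain ⟨n, hn⟩ := exists_nat_gt (-B (y k) (y k) / B (∑ i, (a i : ℚ) • y i) (y k))
    rw [div_lt_iff₀ hlt] at hn
    have := hexpand n
    have : 0 ≤ (n : ℚ) * B (∑ i, (a i : ℚ) • y i) (y k) := by positivity
    linarith
  rw [pair, Finset.sum_eq_zero_iff_of_nonneg fun i _ => term_nonneg a k hk i] at hzero
  simpa [hi] using hzero i (Finset.mem_univ i)

/-- A rationally dependent subfamily satisfies a nontrivial relation with integral coefficients. -/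
lemma exists_int_relation_of_finrank_lt_card {V I : Type*} [AddCommGroup V] [Module ℚ V]
    [FiniteDimensional ℚ V] [Fintype I] (y : I → V) (S : Finset I)
    (hS : Module.finrank ℚ V < S.card) :
    ∃ g : I → ℤ, (∀ i ∉ S, g i = 0) ∧ (∃ i, g i ≠ 0) ∧ ∑ i, (g i : ℚ) • y i = 0 := by
  classical
  have hdep : ¬ LinearIndependent ℤ fun i : S => y i := by
    rw [LinearIndependent.iff_fractionRing ℤ ℚ]
    intro h
    have := h.fintype_card_le_finrank
    rw [Fintype.card_coe] at this
    lia
  obtain ⟨g, hg, i, hi⟩ := Fintype.not_linearIndependent_iff.mp hdep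
  refine ⟨fun j => if h : j ∈ S then g ⟨j, h⟩ else 0, fun j hj => by simp [hj],
    ⟨i, by simpa using hi⟩, ?_⟩
  rw [← Finset.sum_subset (Finset.subset_univ S) fun j _ hj => by simp [hj],
    ← Finset.sum_coe_sort S, ← hg]
  refine Finset.sum_congr rfl fun j _ => ?_
  simp [Int.cast_smul_eq_zsmul]

/-- Any set of more than `dim V` indices contains one whose class is orthogonal to all classes
indexed outside the set. -/
lemma exists_mem_forall_notMem_bilin_eq_zero {V I : Type*} [AddCommGroup V] [Module ℚ V]
    [FiniteDimensional ℚ V] [Fintype I]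
    {B : LinearMap.BilinForm ℚ V} (hsymm : B.IsSymm) {y : I → V}
    (hnn : ∀ i j, i ≠ j → 0 ≤ B (y i) (y j))
    (hnopos : ∀ a : I → ℕ, B (∑ i, (a i : ℚ) • y i) (∑ i, (a i : ℚ) • y i) ≤ 0)
    (S : Finset I) (hS : Module.finrank ℚ V < S.card) :
    ∃ i ∈ S, ∀ k ∉ S, B (y i) (y k) = 0 := by
  obtain ⟨g, hgS, ⟨i, hi⟩, hg⟩ := exists_int_relation_of_finrank_lt_card y S hS
  have hrel : ∑ i, ((g i).toNat : ℚ) • y i = ∑ i, ((-g i).toNat : ℚ) • y i := by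
    rw [← sub_eq_zero, ← Finset.sum_sub_distrib, ← hg]
    refine Finset.sum_congr rfl fun j _ => ?_
    rw [← sub_smul]
    congr 1
    exact_mod_cast Int.toNat_sub_toNat_neg (g j)
  refine ⟨i, by_contra fun h => hi (hgS i h), fun k hk => ?_⟩
  have hgk := hgS k hk
  rcases lt_or_gt_of_ne hi with h | h
  · exact bilin_eq_zero_of_disjoint_relation hsymm hnn hnopos (fun j => by lia) hrel.symm
      (by lia) (by lia)
  · exact bilin_eq_zero_of_disjoint_relation hsymm hnn hnopos (fun j => by lia) hrel
      (by lia) (by lia)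

/-- Key intermediate step in the proof of Lemma 4.1: in a `ρ`-dimensional
`ℚ`-vector space, given a symmetric bilinear form `B` and a family `(y i)` indexed
by a finite set `I` with `#I ≥ ρ² + ρ + 1`, such that `B (y i) (y j) ≥ 0` for
`i ≠ j`, and such that no nonnegative integral combination `D = ∑ a i • y i` has
`B D D > 0`, there exist `ρ + 1` pairwise distinct indices `ν 1, …, ν (ρ+1)` whose
classes are pairwise `B`-orthogonal. -/
theorem stmt_1 {V : Type*} [AddCommGroup V] [Module ℚ V] [FiniteDimensional ℚ V]
    (ρ : ℕ) (hdim : Module.finrank ℚ V = ρ)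
    (B : LinearMap.BilinForm ℚ V) (hsymm : B.IsSymm)
    {I : Type*} [Fintype I] (hI : ρ ^ 2 + ρ + 1 ≤ Fintype.card I)
    (y : I → V)
    (hnn : ∀ i j, i ≠ j → 0 ≤ B (y i) (y j))
    (hnopos : ∀ a : I → ℕ,
      B (∑ i, (a i : ℚ) • y i) (∑ i, (a i : ℚ) • y i) ≤ 0) :
    ∃ ν : Fin (ρ + 1) → I, Function.Injective ν ∧
      ∀ k l, k ≠ l → B (y (ν k)) (y (ν l)) = 0 := by
  classical
  obtain ⟨e⟩ : Nonempty (Option (Fin ρ × Fin (ρ + 1)) ↪ I) := by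
    apply Function.Embedding.nonempty_of_card_le
    simp only [Fintype.card_option, Fintype.card_prod, Fintype.card_fin]
    linarith
  let block (m : Fin ρ) : Finset I :=
    Finset.univ.map ⟨fun j => e (some (m, j)), fun j j' h => by simpa using h⟩
  have mem_block {m : Fin ρ} {i : I} : i ∈ block m ↔ ∃ j, e (some (m, j)) = i := by
    simp only [block, Finset.mem_map, Finset.mem_univ, true_and]
    rfl
  have hex (m : Fin ρ) := exists_mem_forall_notMem_bilin_eq_zero hsymm hnn hnopos (block m)
    (by simp [block, hdim])
  choose μ hμ horth using hex
  have hdisj {m m' : Fin ρ} (h : m ≠ m') : μ m' ∉ block m := by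
    intro hmem
    obtain ⟨j, hj⟩ := mem_block.mp hmem
    obtain ⟨j', hj'⟩ := mem_block.mp (hμ m')
    have := e.injective (hj.trans hj'.symm)
    simp_all
  have hnone (m : Fin ρ) : e none ∉ block m := by
    simp [mem_block]
  let ν : Option (Fin ρ) → I := fun o => o.elim (e none) μ
  have hν : Function.Injective ν := by
    rintro (_ | m) (_ | m') h
    · rfl
    · change e none = μ m' at h
      exact (hnone m' (h ▸ hμ m')).elim
    · change μ m = e none at h
      exact (hnone m (h ▸ hμ m)).elim
    · change μ m = μ m' at h
      by_contra hne
      exact hdisj (m := m) (m' := m') (by simpa using hne) (h ▸ hμ m)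
  have hνorth : ∀ o o', o ≠ o' → B (y (ν o)) (y (ν o')) = 0 := by
    rintro (_ | m) (_ | m') h
    · exact absurd rfl h
    · exact (hsymm.eq _ _).symm.trans (horth m' _ (hnone m'))
    · exact horth m _ (hnone m)
    · exact horth m _ (hdisj (by simpa using h))
  let f := finSuccEquiv ρ
  exact ⟨ν ∘ f, hν.comp f.injective, fun k l h => hνorth _ _ (f.injective.ne h)⟩
end

section
/- Let V be a finite-dimensional vector space over ℚ with dim V = ρ, let B : V × V → ℚ be a symmetric bilinear form, let I be a finite index set with #I ≥ ρ² + ρ + 1, and let (y_i)_{i∈I} be a family of vectors in V such that B(y_i, y_j) ≥ 0 whenever i ≠ j. Then at least one of the following two alternatives holds: (a) there exist nonnegative integers (a_i)_{i∈I} such that D = Σ_{i∈I} a_i · y_i satisfies B(D, D) > 0; or (b) B(y_i, y_i) ≤ 0 for every i ∈ I, and there exists an index ι ∈ I such that B(y_ι, y_i) = 0 for every i ∈ I. -/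
open Module in
/-- In a space of dimension at most `n`, a positive semidefinite form admits at most `2 * n`
vectors of positive norm whose pairwise products are nonpositive. -/
theorem LinearMap.BilinForm.card_le_two_mul_of_pairwise_nonpos
    {K V I : Type*} [Field K] [LinearOrder K] [IsStrictOrderedRing K]
    [AddCommGroup V] [Module K V] [FiniteDimensional K V]
    (B : LinearMap.BilinForm K V) (hsymm : B.IsSymm) (n : ℕ)
    (W : Submodule K V) (hn : finrank K W ≤ n) (hW : ∀ x ∈ W, 0 ≤ B x x)
    (s : Finset I) (y : I → V) (hy : ∀ i ∈ s, y i ∈ W) (hpos : ∀ i ∈ s, 0 < B (y i) (y i))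
    (hnp : ∀ i ∈ s, ∀ j ∈ s, i ≠ j → B (y i) (y j) ≤ 0) : s.card ≤ 2 * n := by
  classical
  induction n generalizing W s y with
  | zero =>
    rcases s.eq_empty_or_nonempty with rfl | ⟨i, hi⟩
    · simp
    · have hbot : W = ⊥ := Submodule.finrank_eq_zero.mp (by lia)
      have h0 : y i = 0 := by simpa [hbot] using hy i hi
      simpa [h0] using hpos i hi
  | succ n ih =>
    rcases s.eq_empty_or_nonempty with rfl | ⟨o, ho⟩
    · simp
    have hb : 0 < B (y o) (y o) := hpos o ho
    -- the orthogonal projections of the vectors to the complement of `y o`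
    set z : I → V := fun i => y i - (B (y o) (y i) / B (y o) (y o)) • y o with hz
    have hBz : ∀ i j, B (z i) (z j) =
        B (y i) (y j) - B (y o) (y i) * B (y o) (y j) / B (y o) (y o) := by
      intro i j
      have h : B (y o) (y i) = B (y i) (y o) := hsymm.eq (y o) (y i)
      simp only [hz, map_sub, map_smul, LinearMap.sub_apply, LinearMap.smul_apply, smul_eq_mul,
        ← h]
      field_simp
      ring
    have hzo : ∀ i, B (y o) (z i) = 0 := by
      intro i
      simp only [hz, map_sub, map_smul, smul_eq_mul]
      field_simp
      ring
    have hzW : ∀ i ∈ s, z i ∈ W := fun i hi =>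
      W.sub_mem (hy i hi) (W.smul_mem _ (hy o ho))
    have hlt : W ⊓ LinearMap.ker (B (y o)) < W := by
      refine lt_of_le_of_ne inf_le_left fun h => hb.ne' ?_
      exact (inf_eq_left.mp h) (hy o ho)
    have hrank := Submodule.finrank_lt_finrank_of_lt hlt
    have hcard := ih (W ⊓ LinearMap.ker (B (y o))) (by lia) (fun x hx => hW x hx.1)
      ((s.erase o).filter fun i => 0 < B (z i) (z i)) z
      (fun i hi => ⟨hzW i (by simp at hi; exact hi.1.2), hzo i⟩)
      (fun i hi => (Finset.mem_filter.mp hi).2)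
      (fun i hi j hj hij => by
        simp only [Finset.mem_filter, Finset.mem_erase] at hi hj
        have h1 := hnp i hi.1.2 j hj.1.2 hij
        have h2 := hnp o ho i hi.1.2 hi.1.1.symm
        have h3 := hnp o ho j hj.1.2 hj.1.1.symm
        have h4 := div_nonneg (mul_nonneg_of_nonpos_of_nonpos h2 h3) hb.le
        rw [hBz]
        linarith)
    have hnull : ((s.erase o).filter fun i => ¬ 0 < B (z i) (z i)).card ≤ 1 := by
      refine Finset.card_le_one.mpr fun i hi j hj => ?_
      by_contra hij
      simp only [Finset.mem_filter, Finset.mem_erase] at hi hj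
      have hneg : ∀ k, (k ≠ o ∧ k ∈ s) ∧ ¬ 0 < B (z k) (z k) → B (y o) (y k) < 0 := by
        intro k hk
        refine lt_of_le_of_ne (hnp o ho k hk.1.2 hk.1.1.symm) fun h => hk.2 ?_
        rw [hBz, h]
        simpa using hpos k hk.1.2
      have h1 := hnp i hi.1.2 j hj.1.2 hij
      have h2 := div_pos (mul_pos_of_neg_of_neg (hneg i hi) (hneg j hj)) hb
      have h3 := hW _ (W.add_mem (hzW i hi.1.2) (hzW j hj.1.2))
      have h4 := hBz i j
      have h5 : B (z i) (z j) = B (z j) (z i) := hsymm.eq (z i) (z j)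
      simp only [map_add, LinearMap.add_apply] at h3
      linarith [hi.2, hj.2]
    have hsplit := Finset.card_filter_add_card_filter_not (s := s.erase o)
      (fun i => 0 < B (z i) (z i))
    have herase := Finset.card_erase_add_one ho
    lia

/-- A finite family of nonnegative rationals has a common denominator. -/
theorem Rat.exists_common_den_of_nonneg {I : Type*} [Fintype I] (c : I → ℚ) (hc : ∀ i, 0 ≤ c i) :
    ∃ N : ℕ, 0 < N ∧ ∃ a : I → ℕ, ∀ i, (a i : ℚ) = N * c i := by
  refine ⟨∏ i, (c i).den, Finset.prod_pos fun i _ => (c i).den_pos, ?_⟩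
  suffices h : ∀ i, ∃ k : ℕ, (k : ℚ) = (∏ i, (c i).den : ℕ) * c i from Classical.skolem.mp h
  intro i
  obtain ⟨k, hk⟩ := Finset.dvd_prod_of_mem (fun i => (c i).den) (Finset.mem_univ i)
  refine ⟨k * (c i).num.toNat, ?_⟩
  have hnum : (((c i).num.toNat : ℤ) : ℚ) = (c i).num := by
    rw [Int.toNat_of_nonneg (Rat.num_nonneg.mpr (hc i))]
  rw [hk]
  push_cast at hnum ⊢
  rw [hnum, ← Rat.mul_den_eq_num]
  ring

/-- If a family has nonnegative products off the diagonal and every natural combination of it has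
nonpositive norm, then the form is negative semidefinite on its span. -/
theorem LinearMap.BilinForm.nonpos_on_span_of_nat_combinations {V I : Type*} [AddCommGroup V]
    [Module ℚ V] [Fintype I] (B : LinearMap.BilinForm ℚ V) (y : I → V)
    (hnn : ∀ i j, i ≠ j → 0 ≤ B (y i) (y j))
    (h : ∀ a : I → ℕ, B (∑ i, (a i : ℚ) • y i) (∑ i, (a i : ℚ) • y i) ≤ 0)
    (x : V) (hx : x ∈ Submodule.span ℚ (Set.range y)) : B x x ≤ 0 := by
  obtain ⟨c, rfl⟩ := (Submodule.mem_span_range_iff_exists_fun ℚ).mp hx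
  have hexp : ∀ d : I → ℚ, B (∑ i, d i • y i) (∑ i, d i • y i) =
      ∑ i, ∑ j, d i * d j * B (y i) (y j) := by
    intro d
    simp only [map_sum, LinearMap.sum_apply, map_smul, LinearMap.smul_apply, smul_eq_mul,
      Finset.mul_sum]
    rw [Finset.sum_comm]
    exact Finset.sum_congr rfl fun i _ => Finset.sum_congr rfl fun j _ => by ring
  have habs : B (∑ i, c i • y i) (∑ i, c i • y i) ≤
      B (∑ i, |c i| • y i) (∑ i, |c i| • y i) := by
    rw [hexp, hexp]
    refine Finset.sum_le_sum fun i _ => Finset.sum_le_sum fun j _ => ?_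
    rcases eq_or_ne i j with rfl | hij
    · rw [abs_mul_abs_self]
    · rw [← abs_mul]
      exact mul_le_mul_of_nonneg_right (le_abs_self _) (hnn i j hij)
  obtain ⟨N, hN, a, ha⟩ := Rat.exists_common_den_of_nonneg (fun i => |c i|) fun i => abs_nonneg _
  have hsum : ∑ i, (a i : ℚ) • y i = (N : ℚ) • ∑ i, |c i| • y i := by
    simp only [ha, mul_smul, Finset.smul_sum]
  have hNa := h a
  rw [hsum] at hNa
  simp only [map_smul, LinearMap.smul_apply, smul_eq_mul] at hNa
  have hNpos : (0 : ℚ) < N := by exact_mod_cast hN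
  exact habs.trans (nonpos_of_mul_nonpos_right (nonpos_of_mul_nonpos_right hNa hNpos) hNpos)

/-- Claim 4.5 (dichotomy): in a `ρ`-dimensional `ℚ`-vector space with a symmetric
bilinear form `B`, given a family `(y i)` indexed by a finite set `I` with
`#I ≥ ρ² + ρ + 1` and `B (y i) (y j) ≥ 0` for `i ≠ j`, then either some nonnegative
integral combination `D = ∑ a i • y i` has `B D D > 0`, or all self-pairings
`B (y i) (y i)` are `≤ 0` and some index `ι` satisfies `B (y ι) (y i) = 0` for
every `i`. -/
theorem stmt_3 {V : Type*} [AddCommGroup V] [Module ℚ V] [FiniteDimensional ℚ V]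
    (ρ : ℕ) (hdim : Module.finrank ℚ V = ρ)
    (B : LinearMap.BilinForm ℚ V) (hsymm : B.IsSymm)
    {I : Type*} [Fintype I] (hI : ρ ^ 2 + ρ + 1 ≤ Fintype.card I)
    (y : I → V)
    (hnn : ∀ i j, i ≠ j → 0 ≤ B (y i) (y j)) :
    (∃ a : I → ℕ,
        0 < B (∑ i, (a i : ℚ) • y i) (∑ i, (a i : ℚ) • y i)) ∨
    ((∀ i, B (y i) (y i) ≤ 0) ∧ ∃ ι : I, ∀ i, B (y ι) (y i) = 0) := by
  classical
  refine or_iff_not_imp_left.mpr fun hna => ?_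
  have hW := B.nonpos_on_span_of_nat_combinations y hnn fun a => not_lt.mp fun ha => hna ⟨a, ha⟩
  have hy : ∀ i, y i ∈ Submodule.span ℚ (Set.range y) := fun i => Submodule.subset_span ⟨i, rfl⟩
  have hdiag : ∀ i, B (y i) (y i) ≤ 0 := fun i => hW _ (hy i)
  refine ⟨hdiag, ?_⟩
  have hnull : ∃ ι, B (y ι) (y ι) = 0 := by
    by_contra! hne
    have hcard := LinearMap.BilinForm.card_le_two_mul_of_pairwise_nonpos (-B) hsymm.neg ρ
      (Submodule.span ℚ (Set.range y)) (hdim ▸ Submodule.finrank_le _)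
      (fun x hx => by simpa using hW x hx) Finset.univ y (fun i _ => hy i)
      (fun i _ => by simpa using lt_of_le_of_ne (hdiag i) (hne i))
      (fun i _ j _ hij => by simpa using hnn i j hij)
    rw [Finset.card_univ] at hcard
    nlinarith [sq_nonneg ((ρ : ℤ) - 1)]
  obtain ⟨ι, hι⟩ := hnull
  refine ⟨ι, fun i => ?_⟩
  rcases eq_or_ne ι i with rfl | hi
  · exact hι
  by_contra hne
  have hb : 0 < B (y ι) (y i) := lt_of_le_of_ne (hnn ι i hi) (Ne.symm hne)
  have h := hW _ (Submodule.add_mem _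
    (Submodule.smul_mem _ ((1 - B (y i) (y i)) / (2 * B (y ι) (y i))) (hy ι)) (hy i))
  have hs : B (y ι) (y i) = B (y i) (y ι) := hsymm.eq (y ι) (y i)
  simp only [map_add, map_smul, LinearMap.add_apply, LinearMap.smul_apply, smul_eq_mul, hι,
    ← hs] at h
  field_simp at h
  nlinarith [mul_pos hb hb]
end
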